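/- arXiv:math/0604470 — 2 statements merged into one kernel-verified Lean document; each statement's English description precedes it below -/
import Mathlib

section
/- The set of Brjuno numbers is invariant under multiplication by nonzero rationals: if θ is irrational with Y(θ) < ∞ and m is a positive integer, then Y(mθ) < ∞ and Y(θ/m) < ∞. -/
open scoped ENNReal
open Classical

/-- The Gauss-map iterates of `θ`: `θ_0 = {θ}`, `θ_{n+1} = {1/θ_n}`. -/
noncomputable def gaussIter (θ : ℝ) : ℕ → ℝ
  | 0 => Int.fract θ
  | n + 1 => Int.fract (1 / gaussIter θ n)

/-- Yoccoz's Brjuno function `Y(θ) = ∑ θ_0⋯θ_{n-1} log(1/θ_n) ∈ (0, ∞]` for irrational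
`θ`, and `Y(θ) = ∞` for rational `θ`. -/
noncomputable def brjunoY (θ : ℝ) : ℝ≥0∞ :=
  if Irrational θ then
    ∑' n : ℕ,
      ENNReal.ofReal ((∏ i ∈ Finset.range n, gaussIter θ i) * Real.log (1 / gaussIter θ n))
  else ⊤

noncomputable def bp (θ : ℝ) (n : ℕ) : ℝ := ∏ i ∈ Finset.range n, gaussIter θ i

noncomputable def qd (θ : ℝ) : ℕ → ℕ
  | 0 => 0
  | 1 => 1
  | n + 2 => ⌊1 / gaussIter θ n⌋₊ * qd θ (n + 1) + qd θ n

theorem fract_pos_lt {x : ℝ} (hx : Irrational x) :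
    Irrational (Int.fract x) ∧ 0 < Int.fract x ∧ Int.fract x < 1 := by
  have h1 : Irrational (Int.fract x) := by
    rw [Int.fract]; exact hx.sub_intCast _
  refine ⟨h1, lt_of_le_of_ne (Int.fract_nonneg x) (fun h => ?_), Int.fract_lt_one x⟩
  rw [← h] at h1
  exact h1 ⟨0, by simp⟩

theorem gi_prop {θ : ℝ} (hθ : Irrational θ) (n : ℕ) :
    Irrational (gaussIter θ n) ∧ 0 < gaussIter θ n ∧ gaussIter θ n < 1 := by
  induction n with
  | zero => exact fract_pos_lt hθ
  | succ n ih =>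
    have : Irrational (1 / gaussIter θ n) := by
      rw [one_div]; exact ih.1.inv
    exact fract_pos_lt this

theorem bp_pos {θ : ℝ} (hθ : Irrational θ) (n : ℕ) : 0 < bp θ n :=
  Finset.prod_pos fun i _ => (gi_prop hθ i).2.1

theorem bp_succ (θ : ℝ) (n : ℕ) : bp θ (n + 1) = bp θ n * gaussIter θ n :=
  Finset.prod_range_succ _ _

theorem bp_zero (θ : ℝ) : bp θ 0 = 1 := by simp [bp]

theorem bp_one (θ : ℝ) : bp θ 1 = Int.fract θ := by simp [bp, gaussIter]

theorem bp_succ_le {θ : ℝ} (hθ : Irrational θ) (n : ℕ) : bp θ (n + 1) ≤ bp θ n := by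
  rw [bp_succ]
  nlinarith [bp_pos hθ n, (gi_prop hθ n).2.2]

theorem bp_le_one {θ : ℝ} (hθ : Irrational θ) (n : ℕ) : bp θ n ≤ 1 := by
  induction n with
  | zero => simp [bp]
  | succ n ih => exact (bp_succ_le hθ n).trans ih

theorem bp_rec {θ : ℝ} (hθ : Irrational θ) (n : ℕ) :
    bp θ (n + 2) = bp θ n - (⌊1 / gaussIter θ n⌋₊ : ℝ) * bp θ (n + 1) := by
  have hx := (gi_prop hθ n).2.1
  have h : gaussIter θ (n + 1) = 1 / gaussIter θ n - (⌊1 / gaussIter θ n⌋₊ : ℝ) := by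
    rw [gaussIter, Int.fract, natCast_floor_eq_intCast_floor (by positivity)]
  rw [bp_succ θ (n + 1), h, bp_succ]
  field_simp

theorem a_pos {θ : ℝ} (hθ : Irrational θ) (n : ℕ) : 1 ≤ ⌊1 / gaussIter θ n⌋₊ := by
  have hx := (gi_prop hθ n).2
  rw [Nat.one_le_floor_iff, le_div_iff₀ hx.1]
  linarith [hx.2]

theorem bp_half {θ : ℝ} (hθ : Irrational θ) (n : ℕ) : bp θ (n + 2) ≤ bp θ n / 2 := by
  have h1 := bp_rec hθ n
  have h2 : (1 : ℝ) ≤ (⌊1 / gaussIter θ n⌋₊ : ℝ) := by exact_mod_cast a_pos hθ n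
  have h3 := bp_succ_le hθ (n + 1)
  have h4 := bp_pos hθ (n + 1)
  have h5 : bp θ (n + 1 + 1) = bp θ (n + 2) := rfl
  nlinarith

theorem qd_ge {θ : ℝ} (hθ : Irrational θ) (n : ℕ) :
    qd θ (n + 1) + qd θ n ≤ qd θ (n + 1 + 1) := by
  rw [qd]
  have := a_pos hθ n
  nlinarith [Nat.zero_le (qd θ (n + 1))]

theorem qd_pos {θ : ℝ} (hθ : Irrational θ) (n : ℕ) : 1 ≤ qd θ (n + 1) := by
  induction n with
  | zero => simp [qd]
  | succ n ih => have := qd_ge hθ n; omega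

theorem qd_mono {θ : ℝ} (hθ : Irrational θ) (n : ℕ) : qd θ n ≤ qd θ (n + 1) := by
  cases n with
  | zero => simp [qd]
  | succ n => have := qd_ge hθ n; omega

theorem qd_unb {θ : ℝ} (hθ : Irrational θ) (n : ℕ) : n ≤ qd θ (n + 1) := by
  induction n with
  | zero => simp
  | succ n ih =>
    cases n with
    | zero => exact qd_pos hθ 1
    | succ n => have := qd_ge hθ (n + 1); have := qd_pos hθ n; omega

theorem qd_two {θ : ℝ} (hθ : Irrational θ) (n : ℕ) : 2 * qd θ (n + 1) ≤ qd θ (n + 1 + 1 + 1) := by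
  have := qd_ge hθ (n + 1)
  have := qd_mono hθ (n + 1)
  omega

theorem qd_bp {θ : ℝ} (hθ : Irrational θ) (n : ℕ) :
    (qd θ (n + 1) : ℝ) * bp θ n + qd θ n * bp θ (n + 1) = 1 := by
  induction n with
  | zero => simp [qd, bp]
  | succ n ih =>
    rw [bp_rec hθ n, qd]
    push_cast
    linarith

theorem qb_le {θ : ℝ} (hθ : Irrational θ) (n : ℕ) : (qd θ (n + 1) : ℝ) * bp θ n ≤ 1 := by
  have := qd_bp hθ n
  have := bp_pos hθ (n + 1)
  have : 0 ≤ (qd θ n : ℝ) * bp θ (n + 1) := by positivity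
  linarith

theorem qb_ge {θ : ℝ} (hθ : Irrational θ) (n : ℕ) : 1 ≤ 2 * ((qd θ (n + 1) : ℝ) * bp θ n) := by
  have := qd_bp hθ n
  have h1 := bp_pos hθ (n + 1)
  have h2 : (qd θ n : ℝ) ≤ qd θ (n + 1) := by exact_mod_cast qd_mono hθ n
  have : (qd θ n : ℝ) * bp θ (n + 1) ≤ qd θ (n + 1) * bp θ n :=
    mul_le_mul h2 (bp_succ_le hθ n) h1.le (by positivity)
  linarith

theorem decomp {θ : ℝ} (hθ : Irrational θ) (p q : ℤ) (n : ℕ) :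
    ∃ u v : ℤ, q = u * qd θ n + v * qd θ (n + 1) ∧
      (q : ℝ) * θ - p = (-1) ^ n * (v * bp θ (n + 1) - u * bp θ n) := by
  induction n with
  | zero =>
    refine ⟨p - q * ⌊θ⌋, q, by simp [qd], ?_⟩
    rw [bp_one, bp_zero, Int.fract]
    push_cast
    ring
  | succ n ih =>
    obtain ⟨u, v, h1, h2⟩ := ih
    refine ⟨v - ⌊1 / gaussIter θ n⌋₊ * u, u, ?_, ?_⟩
    · rw [h1, qd]; push_cast; ring
    · rw [h2, bp_rec hθ n]; push_cast; ring

theorem real_q {θ : ℝ} (hθ : Irrational θ) (n : ℕ) :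
    (∃ p : ℤ, (qd θ n : ℝ) * θ - p = -(-1) ^ n * bp θ n) ∧
    (∃ p : ℤ, (qd θ (n + 1) : ℝ) * θ - p = (-1) ^ n * bp θ (n + 1)) := by
  induction n with
  | zero =>
    refine ⟨⟨1, by simp [qd, bp]⟩, ⟨⌊θ⌋, ?_⟩⟩
    rw [bp_one, Int.fract]; simp [qd]
  | succ n ih =>
    obtain ⟨⟨p, hp⟩, ⟨r, hr⟩⟩ := ih
    refine ⟨⟨r, by rw [hr]; ring⟩, ⟨⌊1 / gaussIter θ n⌋₊ * r + p, ?_⟩⟩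
    rw [bp_rec hθ n, qd]
    push_cast
    linear_combination hp + (⌊1 / gaussIter θ n⌋₊ : ℝ) * hr

theorem best_approx {θ : ℝ} (hθ : Irrational θ) (p q : ℤ) (n : ℕ) (h0 : 0 < q)
    (hq : q < qd θ (n + 1)) : bp θ n ≤ |(q : ℝ) * θ - p| := by
  obtain ⟨u, v, h1, h2⟩ := decomp hθ p q n
  rw [h2, abs_mul, abs_pow, abs_neg, abs_one, one_pow, one_mul]
  have hb := bp_pos hθ n
  have hb1 := bp_pos hθ (n + 1)
  have hQ : (0 : ℤ) ≤ qd θ n := by positivity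
  have hQ1 : (1 : ℤ) ≤ qd θ (n + 1) := by exact_mod_cast qd_pos hθ n
  rcases lt_trichotomy u 0 with hu | hu | hu
  · have hv : 0 ≤ v := by
      by_contra hv
      push Not at hv
      nlinarith
    have hu' : (u : ℝ) ≤ -1 := by exact_mod_cast (by omega : u ≤ -1)
    have hv' : (0 : ℝ) ≤ v := by exact_mod_cast hv
    refine le_trans ?_ (le_abs_self _)
    nlinarith [mul_nonneg hv' hb1.le]
  · exfalso
    subst hu
    have hv : 0 < v := by
      by_contra hv
      push Not at hv
      nlinarith
    nlinarith
  · have hv : v ≤ 0 := by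
      by_contra hv
      push Not at hv
      nlinarith
    have hu' : (1 : ℝ) ≤ u := by exact_mod_cast hu
    have hv' : (v : ℝ) ≤ 0 := by exact_mod_cast hv
    refine le_trans ?_ (neg_le_abs _)
    nlinarith [mul_nonneg (neg_nonneg.2 hv') hb1.le]

/-- Diophantine characterization. -/
def DC (θ : ℝ) : Prop := ∃ f : ℕ → ℝ≥0∞, ∑' k, ((2 : ℝ≥0∞) ^ k)⁻¹ * f k ≠ ⊤ ∧
  ∀ (k : ℕ) (q p : ℤ), 0 < q → q ≤ 2 ^ k → ENNReal.ofReal (-Real.log |(q : ℝ) * θ - p|) ≤ f k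

theorem Y_of_DC {θ : ℝ} (hθ : Irrational θ) (h : DC θ) : brjunoY θ < ⊤ := by
  obtain ⟨f, hf, hk⟩ := h
  rw [brjunoY, if_pos hθ]
  set c : ℕ → ℕ := fun n => Nat.clog 2 (qd θ (n + 1)) with hc
  set g : ℕ → ℝ≥0∞ := fun k => ((2 : ℝ≥0∞) ^ k)⁻¹ * f k with hg
  have hstep : ∀ n, c n < c (n + 2) := by
    intro n
    have h1 : Nat.clog 2 (2 * qd θ (n + 1)) ≤ c (n + 2) := Nat.clog_mono_right 2 (qd_two hθ n)
    have h2 : Nat.clog 2 (2 * qd θ (n + 1)) = c n + 1 := by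
      have := qd_pos hθ n
      rw [Nat.clog_of_two_le (by norm_num) (by omega)]
      congr 2
      omega
    omega
  have hterm : ∀ n, ENNReal.ofReal ((∏ i ∈ Finset.range n, gaussIter θ i) *
      Real.log (1 / gaussIter θ n)) ≤ 2 * g (c n) := by
    intro n
    have hb := bp_pos hθ n
    have hx := (gi_prop hθ n).2
    change ENNReal.ofReal (bp θ n * Real.log (1 / gaussIter θ n)) ≤ _
    have hQ : qd θ (n + 1) ≤ 2 ^ c n := Nat.le_pow_clog (by norm_num) _
    have hQ2 : 2 ^ c n ≤ 2 * qd θ (n + 1) := by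
      have h1 := qd_pos hθ n
      rcases Nat.lt_or_ge 1 (qd θ (n + 1)) with h2 | h2
      · have h3 : 2 ^ (c n).pred < qd θ (n + 1) := Nat.pow_pred_clog_lt_self (by norm_num) h2
        have h4 : 0 < c n := Nat.clog_pos (by norm_num) h2
        have h5 : c n = (c n).pred + 1 := by rw [Nat.pred_eq_sub_one]; omega
        rw [h5, pow_succ]; omega
      · have h3 : c n = 0 := Nat.clog_of_right_le_one h2 2
        rw [h3]; omega
    obtain ⟨p, hp⟩ := (real_q hθ n).2
    have h1 := hk (c n) (qd θ (n + 1)) p (by exact_mod_cast qd_pos hθ n) (by exact_mod_cast hQ)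
    rw [Int.cast_natCast, hp, abs_mul, abs_pow, abs_neg, abs_one, one_pow, one_mul,
      abs_of_pos (bp_pos hθ _)] at h1
    have h2 : Real.log (1 / gaussIter θ n) ≤ -Real.log (bp θ (n + 1)) := by
      rw [bp_succ, Real.log_mul hb.ne' hx.1.ne', one_div, Real.log_inv]
      have := Real.log_nonpos hb.le (bp_le_one hθ n)
      linarith
    have h3 : bp θ n ≤ 2 * ((2 : ℝ) ^ c n)⁻¹ := by
      rw [← div_eq_mul_inv, le_div_iff₀ (by positivity)]
      have h5 : (2 : ℝ) ^ c n ≤ 2 * qd θ (n + 1) := by exact_mod_cast hQ2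
      nlinarith [qb_le hθ n]
    rw [ENNReal.ofReal_mul hb.le, hg, ← mul_assoc]
    refine mul_le_mul' ?_ ((ENNReal.ofReal_le_ofReal h2).trans h1)
    refine (ENNReal.ofReal_le_ofReal h3).trans (le_of_eq ?_)
    rw [ENNReal.ofReal_mul (by norm_num), ENNReal.ofReal_inv_of_pos (by positivity),
      ENNReal.ofReal_pow (by norm_num)]
    norm_num
  refine (ENNReal.tsum_le_tsum hterm).trans_lt ?_
  rw [ENNReal.tsum_mul_left]
  refine ENNReal.mul_lt_top (by norm_num) ?_
  rw [← tsum_even_add_odd ENNReal.summable ENNReal.summable]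
  have i1 : Function.Injective (fun n => c (2 * n)) :=
    (strictMono_nat_of_lt_succ fun n => hstep (2 * n)).injective
  have i2 : Function.Injective (fun n => c (2 * n + 1)) :=
    (strictMono_nat_of_lt_succ fun n => hstep (2 * n + 1)).injective
  refine ENNReal.add_lt_top.2 ⟨?_, ?_⟩
  · exact (ENNReal.tsum_comp_le_tsum_of_injective i1 g).trans_lt hf.lt_top
  · exact (ENNReal.tsum_comp_le_tsum_of_injective i2 g).trans_lt hf.lt_top

theorem bp_geom {θ : ℝ} (hθ : Irrational θ) (n : ℕ) :
    bp θ n ≤ (2 * (9 / 10) ^ n) ^ 2 ∧ bp θ (n + 1) ≤ (2 * (9 / 10) ^ (n + 1)) ^ 2 := by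
  induction n with
  | zero =>
    have := bp_le_one hθ 0
    have := bp_le_one hθ 1
    norm_num at *
    constructor <;> linarith
  | succ n ih =>
    refine ⟨ih.2, (bp_half hθ n).trans ?_⟩
    have h1 := ih.1
    have : (2 * (9 / 10 : ℝ) ^ (n + 1 + 1)) ^ 2 = (2 * (9 / 10) ^ n) ^ 2 * (6561 / 10000) := by ring
    rw [this]
    have := sq_nonneg (2 * (9 / 10 : ℝ) ^ n)
    linarith

theorem bp_log {θ : ℝ} (hθ : Irrational θ) (n : ℕ) :
    bp θ n * (-Real.log (bp θ n)) ≤ 4 * (9 / 10) ^ n := by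
  have hb := bp_pos hθ n
  set s := √(bp θ n) with hs
  have hs0 : 0 < s := Real.sqrt_pos.2 hb
  have hsq : s ^ 2 = bp θ n := Real.sq_sqrt hb.le
  have h1 : s ≤ 2 * (9 / 10) ^ n := by
    rw [hs, Real.sqrt_le_left (by positivity)]
    exact (bp_geom hθ n).1
  have h2 : -Real.log s ≤ s⁻¹ := by
    have := Real.log_le_sub_one_of_pos (inv_pos.2 hs0)
    rw [Real.log_inv] at this
    linarith
  rw [← hsq, Real.log_pow]
  have h3 : s ^ 2 * (-Real.log s) ≤ s ^ 2 * s⁻¹ := by gcongr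
  have h4 : s ^ 2 * s⁻¹ = s := by field_simp
  push_cast
  linarith

theorem geom_tail (j : ℕ) :
    ∑' k, (if j ≤ k then ((2 : ℝ≥0∞) ^ k)⁻¹ else 0) = 2 * (2 ^ j)⁻¹ := by
  rw [← ENNReal.summable.sum_add_tsum_nat_add' (k := j)]
  rw [Finset.sum_eq_zero (fun i hi => if_neg (by simpa using hi)), zero_add]
  have : ∀ k, (if j ≤ k + j then ((2 : ℝ≥0∞) ^ (k + j))⁻¹ else 0) = (2⁻¹) ^ k * (2 ^ j)⁻¹ := by
    intro k
    rw [if_pos (by omega), pow_add, ENNReal.mul_inv (by simp) (by simp), ENNReal.inv_pow]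
  simp_rw [this]
  rw [ENNReal.tsum_mul_right, ENNReal.tsum_geometric]
  simp

theorem DC_of_Y {θ : ℝ} (hθ : Irrational θ) (h : brjunoY θ < ⊤) : DC θ := by
  rw [brjunoY, if_pos hθ] at h
  set L : ℕ → ℝ≥0∞ := fun n => ENNReal.ofReal (-Real.log (bp θ (n + 1))) with hL
  refine ⟨fun k => ∑' n, if qd θ (n + 1) ≤ 2 ^ k then L n else 0, ?_, ?_⟩
  · simp_rw [← ENNReal.tsum_mul_left]
    rw [ENNReal.tsum_comm]
    have key : ∀ n, ∑' k, ((2 : ℝ≥0∞) ^ k)⁻¹ * (if qd θ (n + 1) ≤ 2 ^ k then L n else 0) ≤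
        4 * (ENNReal.ofReal ((∏ i ∈ Finset.range n, gaussIter θ i) *
          Real.log (1 / gaussIter θ n)) + ENNReal.ofReal (4 * (9 / 10) ^ n)) := by
      intro n
      have hb := bp_pos hθ n
      have hx := (gi_prop hθ n).2
      change _ ≤ 4 * (ENNReal.ofReal (bp θ n * Real.log (1 / gaussIter θ n)) + _)
      set j := Nat.clog 2 (qd θ (n + 1)) with hj
      have e : ∀ k, ((2 : ℝ≥0∞) ^ k)⁻¹ * (if qd θ (n + 1) ≤ 2 ^ k then L n else 0) =
          (if j ≤ k then ((2 : ℝ≥0∞) ^ k)⁻¹ else 0) * L n := by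
        intro k
        have : qd θ (n + 1) ≤ 2 ^ k ↔ j ≤ k := by
          rw [hj, Nat.clog_le_iff_le_pow (by norm_num)]
        by_cases hk : j ≤ k
        · rw [if_pos hk, if_pos (this.2 hk)]
        · rw [if_neg hk, if_neg (mt this.1 hk)]; simp
      simp_rw [e]
      rw [ENNReal.tsum_mul_right, geom_tail]
      have hQ : qd θ (n + 1) ≤ 2 ^ j := Nat.le_pow_clog (by norm_num) _
      have h3 : ((2 : ℝ) ^ j)⁻¹ ≤ 2 * bp θ n := by
        rw [inv_le_iff_one_le_mul₀ (by positivity)]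
        have h5 : (qd θ (n + 1) : ℝ) ≤ 2 ^ j := by exact_mod_cast hQ
        nlinarith [qb_ge hθ n]
      have h4 : ((2 : ℝ≥0∞) ^ j)⁻¹ ≤ 2 * ENNReal.ofReal (bp θ n) := by
        have := ENNReal.ofReal_le_ofReal h3
        rw [ENNReal.ofReal_mul (by norm_num), ENNReal.ofReal_inv_of_pos (by positivity),
          ENNReal.ofReal_pow (by norm_num)] at this
        norm_num at this
        exact this
      have h5 : ENNReal.ofReal (bp θ n) * L n ≤
          ENNReal.ofReal (bp θ n * Real.log (1 / gaussIter θ n)) +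
            ENNReal.ofReal (4 * (9 / 10) ^ n) := by
        rw [hL, ← ENNReal.ofReal_mul hb.le]
        refine le_trans (ENNReal.ofReal_le_ofReal ?_) ENNReal.ofReal_add_le
        rw [bp_succ, Real.log_mul hb.ne' hx.1.ne', one_div, Real.log_inv]
        have := bp_log hθ n
        linarith
      calc 2 * ((2 : ℝ≥0∞) ^ j)⁻¹ * L n ≤ 2 * (2 * ENNReal.ofReal (bp θ n)) * L n := by gcongr
        _ = 4 * (ENNReal.ofReal (bp θ n) * L n) := by ring
        _ ≤ _ := by gcongr
    refine ((ENNReal.tsum_le_tsum key).trans_lt ?_).ne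
    rw [ENNReal.tsum_mul_left, ENNReal.tsum_add]
    refine ENNReal.mul_lt_top (by norm_num) (ENNReal.add_lt_top.2 ⟨h, ?_⟩)
    refine Summable.tsum_ofReal_lt_top ?_
    exact (summable_geometric_of_lt_one (by norm_num) (by norm_num)).mul_left _
  · intro k q p h0 hq
    have hex : ∃ n, 2 ^ k < qd θ (n + 1) :=
      ⟨2 ^ k + 1, lt_of_lt_of_le (Nat.lt_succ_self _) (qd_unb hθ _)⟩
    obtain ⟨j, hj⟩ : ∃ j, Nat.find hex = j + 1 := by
      refine Nat.exists_eq_succ_of_ne_zero fun h0 => ?_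
      have := Nat.find_spec hex
      rw [h0] at this
      have h2 : 1 ≤ 2 ^ k := Nat.one_le_two_pow
      simp [qd] at this
    have hs := Nat.find_spec hex
    have hm := Nat.find_min hex (m := j) (by omega)
    rw [hj] at hs
    push Not at hm
    have hb := best_approx hθ p q (j + 1) h0 (lt_of_le_of_lt hq (by exact_mod_cast hs))
    refine le_trans ?_ (ENNReal.le_tsum j)
    rw [if_pos hm]
    refine ENNReal.ofReal_le_ofReal (neg_le_neg ?_)
    exact Real.log_le_log (bp_pos hθ _) hb

theorem DC_mul {θ : ℝ} (h : DC θ) (m : ℕ) (hm : 0 < m) : DC (m * θ) := by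
  obtain ⟨f, hf, hk⟩ := h
  refine ⟨fun k => f (k + m), ?_, ?_⟩
  · have e : ∀ k, ((2 : ℝ≥0∞) ^ k)⁻¹ * f (k + m) =
        2 ^ m * (((2 : ℝ≥0∞) ^ (k + m))⁻¹ * f (k + m)) := by
      intro k
      rw [pow_add, ENNReal.mul_inv (by simp) (by simp), ← mul_assoc, mul_comm _ ((2 ^ m)⁻¹),
        ← mul_assoc, ENNReal.mul_inv_cancel (by simp) (by simp), one_mul]
    simp_rw [e]
    rw [ENNReal.tsum_mul_left]
    refine ENNReal.mul_ne_top (by simp) (ne_top_of_le_ne_top hf ?_)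
    exact ENNReal.tsum_comp_le_tsum_of_injective (add_left_injective m)
      (fun k => ((2 : ℝ≥0∞) ^ k)⁻¹ * f k)
  · intro k q p h0 hq
    have h1 : (m : ℤ) ≤ 2 ^ m := by exact_mod_cast Nat.lt_two_pow_self.le
    have := hk (k + m) (q * m) p (by positivity) (by
      rw [pow_add]; exact mul_le_mul hq h1 (by positivity) (by positivity))
    push_cast at this
    rwa [mul_assoc] at this

theorem DC_div {θ : ℝ} (hθ : Irrational θ) (h : DC θ) (m : ℕ) (hm : 0 < m) : DC (θ / m) := by
  obtain ⟨f, hf, hk⟩ := h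
  refine ⟨fun k => f k + ENNReal.ofReal (Real.log m), ?_, ?_⟩
  · simp_rw [mul_add]
    rw [ENNReal.tsum_add, ENNReal.tsum_mul_right]
    refine ENNReal.add_ne_top.2 ⟨hf, ENNReal.mul_ne_top ?_ ENNReal.ofReal_ne_top⟩
    have := geom_tail 0
    simp only [Nat.zero_le, if_true] at this
    rw [this]; simp
  · intro k q p h0 hq
    have hm' : (0 : ℝ) < m := by exact_mod_cast hm
    refine le_trans ?_ (add_le_add_left (hk k q (p * m) h0 hq) _)
    refine le_trans (ENNReal.ofReal_le_ofReal ?_) ENNReal.ofReal_add_le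
    have e : (q : ℝ) * (θ / m) - p = (q * θ - (p * m : ℤ)) / m := by
      push_cast; field_simp
    have hne : (q : ℝ) * θ - (p * m : ℤ) ≠ 0 :=
      ((hθ.intCast_mul h0.ne').sub_intCast _).ne_zero
    rw [e, abs_div, abs_of_pos hm', Real.log_div (abs_ne_zero.2 hne) hm'.ne']
    linarith

/-- Brjuno numbers are invariant under multiplication and division by positive
integers: if `θ` is irrational with `Y(θ) < ∞` then `Y(mθ) < ∞` and `Y(θ/m) < ∞`. -/
theorem brjuno_invariant_rational_mul (θ : ℝ) (hθ : Irrational θ)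
    (hY : brjunoY θ < ⊤) (m : ℕ) (hm : 0 < m) :
    brjunoY (m * θ) < ⊤ ∧ brjunoY (θ / m) < ⊤ := by
  have h := DC_of_Y hθ hY
  have hm' : m ≠ 0 := hm.ne'
  exact ⟨Y_of_DC (hθ.natCast_mul hm') (DC_mul h m hm),
    Y_of_DC (hθ.div_natCast hm') (DC_div hθ h m hm)⟩
end

section
/- Let (b_n) be a sequence of functions holomorphic on a neighborhood of the closed disk {|a| ≤ r} in ℂ, and suppose there exists M ∈ ℝ such that (1/n) log|b_n(a)| ≤ M for all n ≥ 1 and all |a| = r. Then limsup_{n→∞} (1/n) log|b_n(0)| ≤ (1/2π) ∫_0^{2π} limsup_{n→∞} (1/n) log|b_n(r e^{it})| dt. -/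
open scoped ENNReal
open MeasureTheory

/-- The extended-real sequence `n ↦ (1/n) log |b_n(a)|` (with value `−∞` where
`b_n(a) = 0`), whose `limsup` is `− log` of the radius of convergence. -/
noncomputable def logCoeffLimsup (b : ℕ → ℂ → ℂ) (a : ℂ) : EReal :=
  Filter.limsup
    (fun n : ℕ => (((n : ℝ)⁻¹ : ℝ) : EReal) * ENNReal.log (ENNReal.ofReal ‖b n a‖))
    Filter.atTop

lemma sub_cont (M : ℝ) : Continuous (fun x : EReal => (M : EReal) - x) := by
  rw [continuous_iff_continuousAt]
  intro x
  simp only [sub_eq_add_neg]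
  have h := EReal.continuousAt_add (p := ((M : EReal), -x)) (by simp) (by simp)
  exact ContinuousAt.comp (f := fun x : EReal => ((M : EReal), -x)) h
    (by fun_prop)

lemma jensen_ineq (r : ℝ) (hr : 0 < r) (f : ℂ → ℂ)
    (hf : AnalyticOnNhd ℂ f (Metric.closedBall 0 r)) (h0 : f 0 ≠ 0) :
    Real.log ‖f 0‖ ≤ Real.circleAverage (Real.log ‖f ·‖) 0 r := by
  have hf' : AnalyticOnNhd ℂ f (Metric.closedBall 0 |r|) := by rwa [abs_of_pos hr]
  rw [hf'.circleAverage_log_norm hr.ne' h0]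
  simp only [le_add_iff_nonneg_left]
  refine finsum_nonneg fun u => ?_
  by_cases hu : u ∈ Metric.closedBall (0:ℂ) |r|
  · refine mul_nonneg (mod_cast MeromorphicOn.AnalyticOnNhd.divisor_nonneg hf' ..) ?_
    by_cases h : u = 0
    · simp [h]
    · apply Real.log_nonneg
      rw [abs_of_pos hr] at hu
      have : 0 < ‖u‖ := norm_pos_iff.2 h
      simp only [zero_sub, norm_neg]
      rw [← div_eq_mul_inv, one_le_div this]
      simpa using hu
  · simp [hu]

lemma ae_ne (r : ℝ) (hr : 0 < r) (f : ℂ → ℂ)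
    (hf : AnalyticOnNhd ℂ f (Metric.closedBall 0 r)) (h0 : f 0 ≠ 0) :
    ∀ᵐ t ∂(volume.restrict (Set.Ioc (0 : ℝ) (2 * Real.pi))), f (circleMap 0 r t) ≠ 0 := by
  have hc : IsConnected (Metric.closedBall (0:ℂ) r) :=
    (convex_closedBall _ _).isConnected ⟨0, by simp [hr.le]⟩
  have h1 := hf.preimage_zero_mem_codiscreteWithin h0 (by simp [hr.le]) hc
  have h2 : f ⁻¹' {0}ᶜ ∈ Filter.codiscreteWithin (Metric.sphere (0:ℂ) |r|) := by
    refine Filter.codiscreteWithin_mono ?_ h1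
    rw [abs_of_pos hr]
    exact Metric.sphere_subset_closedBall
  exact ae_restrict_le_codiscreteWithin measurableSet_Ioc
    (Filter.codiscreteWithin_mono (by tauto) (circleMap_preimage_codiscrete hr.ne' h2))

lemma step (r : ℝ) (hr : 0 < r) (f : ℂ → ℂ)
    (hf : AnalyticOnNhd ℂ f (Metric.closedBall 0 r)) (M : ℝ) (n : ℕ) (hn : 1 ≤ n)
    (hM : ∀ a : ℂ, ‖a‖ = r → ‖f a‖ ≤ Real.exp (n * M)) :
    (((n : ℝ)⁻¹ : ℝ) : EReal) * ENNReal.log (ENNReal.ofReal ‖f 0‖) ≤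
      (M : EReal) -
        (((ENNReal.ofReal (2 * Real.pi))⁻¹ *
          ∫⁻ t in Set.Ioc (0 : ℝ) (2 * Real.pi),
            ((M : EReal) - (((n : ℝ)⁻¹ : ℝ) : EReal) *
              ENNReal.log (ENNReal.ofReal ‖f (circleMap 0 r t)‖)).toENNReal) : ℝ≥0∞) := by
  have hn0 : (0:ℝ) < n := by exact_mod_cast hn
  have hpi := Real.two_pi_pos
  by_cases h0 : f 0 = 0
  · simp only [h0, norm_zero, ENNReal.ofReal_zero, ENNReal.log_zero]
    rw [EReal.coe_mul_bot_of_pos (by positivity)]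
    exact bot_le
  have hae := ae_ne r hr f hf h0
  have hJ := jensen_ineq r hr f hf h0
  have hint : CircleIntegrable (Real.log ‖f ·‖) 0 r := by
    apply MeromorphicOn.circleIntegrable_log_norm
    rw [abs_of_pos hr]
    exact (hf.mono Metric.sphere_subset_closedBall).meromorphicOn
  have hint' : IntegrableOn (fun t => Real.log ‖f (circleMap 0 r t)‖)
      (Set.Ioc (0 : ℝ) (2 * Real.pi)) := by
    rw [← intervalIntegrable_iff_integrableOn_Ioc_of_le hpi.le]
    exact hint
  have hI : Integrable (fun t => M - (n:ℝ)⁻¹ * Real.log ‖f (circleMap 0 r t)‖)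
      (volume.restrict (Set.Ioc (0 : ℝ) (2 * Real.pi))) :=
    (integrable_const _).sub (hint'.const_mul _)
  have e1 : ∫⁻ t in Set.Ioc (0 : ℝ) (2 * Real.pi),
            ((M : EReal) - (((n : ℝ)⁻¹ : ℝ) : EReal) *
              ENNReal.log (ENNReal.ofReal ‖f (circleMap 0 r t)‖)).toENNReal
      = ENNReal.ofReal (∫ t in Set.Ioc (0 : ℝ) (2 * Real.pi),
          (M - (n:ℝ)⁻¹ * Real.log ‖f (circleMap 0 r t)‖)) := by
    rw [ofReal_integral_eq_lintegral_ofReal hI]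
    · refine lintegral_congr_ae ?_
      filter_upwards [hae] with t ht
      rw [ENNReal.log_ofReal_of_pos (norm_pos_iff.2 ht), ← EReal.coe_mul, ← EReal.coe_sub,
        EReal.real_coe_toENNReal]
    · filter_upwards [hae] with t ht
      have h1 := hM (circleMap 0 r t) (by simp [abs_of_pos hr])
      have h2 := (Real.log_le_iff_le_exp (norm_pos_iff.2 ht)).2 h1
      simp only [Pi.zero_apply, sub_nonneg]
      rw [inv_mul_le_iff₀ hn0]
      exact h2
  have e2 : ∫ t in Set.Ioc (0 : ℝ) (2 * Real.pi),
          (M - (n:ℝ)⁻¹ * Real.log ‖f (circleMap 0 r t)‖)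
      = (2 * Real.pi) * (M - (n:ℝ)⁻¹ * Real.circleAverage (Real.log ‖f ·‖) 0 r) := by
    rw [integral_sub (integrable_const _) (hint'.const_mul _), integral_const_mul,
      Real.circleAverage_def, intervalIntegral.integral_of_le hpi.le]
    simp only [integral_const, smul_eq_mul]
    simp [hpi.le]
    field_simp
  have hpos : 0 ≤ ∫ t in Set.Ioc (0 : ℝ) (2 * Real.pi),
          (M - (n:ℝ)⁻¹ * Real.log ‖f (circleMap 0 r t)‖) := by
    apply integral_nonneg_of_ae
    filter_upwards [hae] with t ht
    have h1 := hM (circleMap 0 r t) (by simp [abs_of_pos hr])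
    have h2 := (Real.log_le_iff_le_exp (norm_pos_iff.2 ht)).2 h1
    simp only [Pi.zero_apply, sub_nonneg]
    rw [inv_mul_le_iff₀ hn0]
    exact h2
  rw [e1, ← ENNReal.ofReal_inv_of_pos hpi, ← ENNReal.ofReal_mul (by positivity), e2,
    inv_mul_cancel_left₀ hpi.ne', ENNReal.log_ofReal_of_pos (norm_pos_iff.2 h0),
    EReal.coe_ennreal_ofReal, ← EReal.coe_mul, ← EReal.coe_sub, EReal.coe_le_coe_iff]
  rw [e2] at hpos
  rw [max_eq_left (nonneg_of_mul_nonneg_right hpos hpi)]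
  have : (n:ℝ)⁻¹ * Real.log ‖f 0‖ ≤ (n:ℝ)⁻¹ * Real.circleAverage (Real.log ‖f ·‖) 0 r := by
    gcongr
  linarith

/-- Fatou-type inequality for the limsups of `(1/n) log|b_n|`: if each `b_n` is
holomorphic on a neighborhood of the closed disk of radius `r` and
`(1/n) log|b_n(a)| ≤ M` on the circle `|a| = r` (stated equivalently as
`‖b_n(a)‖ ≤ exp (n M)`, which also covers the value `−∞`), then
`limsup (1/n) log|b_n(0)| ≤ (1/2π) ∫_0^{2π} limsup (1/n) log|b_n(r e^{it})| dt`.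
Since the integrand lies in `[−∞, M]`, the circle average is expressed as
`M − (1/2π) ∫⁻ (M − limsup)` with the nonnegative part (via `EReal.abs`, correct since the integrand is `≥ 0`) integrated in `[0, ∞]`. -/
theorem limsup_log_coeff_fatou (r : ℝ) (hr : 0 < r) (U : Set ℂ) (hU : IsOpen U)
    (hUr : Metric.closedBall 0 r ⊆ U) (b : ℕ → ℂ → ℂ)
    (hb : ∀ n, DifferentiableOn ℂ (b n) U) (M : ℝ)
    (hM : ∀ n : ℕ, 1 ≤ n → ∀ a : ℂ, ‖a‖ = r → ‖b n a‖ ≤ Real.exp (n * M)) :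
    logCoeffLimsup b 0 ≤
      (M : EReal) -
        (((ENNReal.ofReal (2 * Real.pi))⁻¹ *
          ∫⁻ t in Set.Ioc (0 : ℝ) (2 * Real.pi),
            ((M : EReal) - logCoeffLimsup b (r * Complex.exp (t * Complex.I))).abs) :
          ℝ≥0∞) := by
  have hB : ∀ n, AnalyticOnNhd ℂ (b n) (Metric.closedBall 0 r) := fun n =>
    ((hb n).analyticOnNhd hU).mono hUr
  have hcirc : ∀ t : ℝ, (r : ℂ) * Complex.exp (t * Complex.I) = circleMap 0 r t := by
    intro t; simp [circleMap]
  have hnorm : ∀ t : ℝ, ‖circleMap 0 r t‖ = r := by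
    intro t; simp [abs_of_pos hr]
  have hanti : Antitone (fun x : EReal => (M : EReal) - x) :=
    fun x y h => EReal.sub_le_sub le_rfl h
  have hle : ∀ t : ℝ, logCoeffLimsup b (circleMap 0 r t) ≤ M := by
    intro t
    refine Filter.limsup_le_of_le (by isBoundedDefault) ?_
    filter_upwards [Filter.eventually_ge_atTop 1] with n hn
    have hn0 : (0:ℝ) < n := by exact_mod_cast hn
    have h1 : ENNReal.log (ENNReal.ofReal ‖b n (circleMap 0 r t)‖) ≤ ((n * M : ℝ) : EReal) := by
      refine (ENNReal.log_le_log (ENNReal.ofReal_le_ofReal (hM n hn _ (hnorm t)))).trans ?_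
      rw [ENNReal.log_ofReal_of_pos (Real.exp_pos _), Real.log_exp]
    refine (mul_le_mul_of_nonneg_left h1 (EReal.coe_nonneg.2 (by positivity))).trans ?_
    rw [← EReal.coe_mul, inv_mul_cancel_left₀ hn0.ne']
  have hφ : ∀ t : ℝ, ((M : EReal) - logCoeffLimsup b (circleMap 0 r t)).abs =
      Filter.liminf (fun n : ℕ => ((M : EReal) - (((n : ℝ)⁻¹ : ℝ) : EReal) *
        ENNReal.log (ENNReal.ofReal ‖b n (circleMap 0 r t)‖)).toENNReal) Filter.atTop := by
    intro t
    have hnn : 0 ≤ (M : EReal) - logCoeffLimsup b (circleMap 0 r t) := by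
      have := hanti (hle t)
      simpa [← EReal.coe_sub] using this
    have habs : ∀ x : EReal, 0 ≤ x → x.abs = x.toENNReal := by
      intro x hx
      induction x with
      | bot => simp at hx
      | top => simp
      | coe x => rw [EReal.abs_def, EReal.real_coe_toENNReal, abs_of_nonneg (EReal.coe_nonneg.1 hx)]
    rw [habs _ hnn]
    exact Antitone.map_limsup_of_continuousAt (f := fun x : EReal => ((M : EReal) - x).toENNReal)
      (fun x y h => EReal.toENNReal_le_toENNReal (hanti h)) _
      (EReal.continuous_toENNReal.comp (sub_cont M)).continuousAt
  have hmeas : ∀ n : ℕ, Measurable (fun t : ℝ => ((M : EReal) - (((n : ℝ)⁻¹ : ℝ) : EReal) *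
        ENNReal.log (ENNReal.ofReal ‖b n (circleMap 0 r t)‖)).toENNReal) := by
    intro n
    have hc : Continuous fun t : ℝ => b n (circleMap 0 r t) :=
      (hB n).continuousOn.comp_continuous (continuous_circleMap 0 r)
        (fun t => by simp [abs_of_pos hr])
    have h1 : Measurable fun t : ℝ => ENNReal.log (ENNReal.ofReal ‖b n (circleMap 0 r t)‖) :=
      ENNReal.measurable_log.comp (ENNReal.measurable_ofReal.comp hc.norm.measurable)
    exact ((sub_cont M).measurable.comp (h1.const_mul _)).ereal_toENNReal
  simp only [hcirc, hφ]
  have hfat := lintegral_liminf_le (μ := volume.restrict (Set.Ioc (0 : ℝ) (2 * Real.pi)))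
    (u := Filter.atTop) hmeas
  have hψa : Antitone (fun y : ℝ≥0∞ =>
      (M : EReal) - (((ENNReal.ofReal (2 * Real.pi))⁻¹ * y : ℝ≥0∞) : EReal)) := by
    intro x y h
    exact hanti (EReal.coe_ennreal_le_coe_ennreal_iff.2 (mul_le_mul_right h _))
  have hψc : Continuous (fun y : ℝ≥0∞ =>
      (M : EReal) - (((ENNReal.ofReal (2 * Real.pi))⁻¹ * y : ℝ≥0∞) : EReal)) :=
    (sub_cont M).comp (continuous_coe_ennreal_ereal.comp
      (ENNReal.continuous_const_mul (by simp [Real.pi_pos])))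
  refine le_trans ?_ (hψa hfat)
  refine le_trans ?_ (Antitone.map_liminf_of_continuousAt hψa _ hψc.continuousAt).ge
  refine Filter.limsup_le_limsup ?_
  filter_upwards [Filter.eventually_ge_atTop 1] with n hn
  exact step r hr (b n) (hB n) M n hn (hM n hn)
end
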